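/- Let T ⊆ B(H,K) be a TRO, X ⊆ T a nondegenerate sub-TRO, and P : T → X a contractive TRO conditional expectation onto X. Then there exists a unique contractive linear map Q' : ⟨T* T⟩ → ⟨T* T⟩ such that Q'(x* a) = x* P(a) for all a ∈ T, x ∈ X. Moreover Q' is idempotent with range ⟨X* X⟩, satisfies Q'(a* x) = P(a)* x for all a ∈ T, x ∈ X, and satisfies Q'(d b) = Q'(d) b and Q'(b d) = b Q'(d) for all d ∈ ⟨T* T⟩ and b ∈ ⟨X* X⟩; that is, Q' is a conditional expectation from the C*-algebra ⟨T* T⟩ onto its C*-subalgebra ⟨X* X⟩. -/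

import Mathlib

noncomputable section

open ContinuousLinearMap

/-- The closed linear span of a set in a complex normed space. -/
def cspan {V : Type*} [NormedAddCommGroup V] [NormedSpace ℂ V] (S : Set V) : Set V :=
  closure (Submodule.span ℂ S : Set V)

variable {H K : Type*} [NormedAddCommGroup H] [InnerProductSpace ℂ H] [CompleteSpace H]
  [NormedAddCommGroup K] [InnerProductSpace ℂ K] [CompleteSpace K]

/-- The ternary product `a b* c` of operators in `B(H,K)`. -/
def tp (a b c : H →L[ℂ] K) : H →L[ℂ] K :=
  a ∘L ((ContinuousLinearMap.adjoint b) ∘L c)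

/-- A TRO: a norm-closed linear subspace of `B(H,K)` stable under `(a,b,c) ↦ a b* c`. -/
def IsTRO (T : Set (H →L[ℂ] K)) : Prop :=
  IsClosed T ∧ (∃ S : Submodule ℂ (H →L[ℂ] K), T = ↑S) ∧
    ∀ a ∈ T, ∀ b ∈ T, ∀ c ∈ T, tp a b c ∈ T

/-- A sub-TRO of `T`: a norm-closed linear subspace of `T` stable under the ternary product. -/
def IsSubTRO (T X : Set (H →L[ℂ] K)) : Prop :=
  X ⊆ T ∧ IsClosed X ∧ (∃ S : Submodule ℂ (H →L[ℂ] K), X = ↑S) ∧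
    ∀ a ∈ X, ∀ b ∈ X, ∀ c ∈ X, tp a b c ∈ X

/-- The set `{a b* : a ∈ T₁, b ∈ T₂} ⊆ B(K)`. -/
def setMulStar (T₁ T₂ : Set (H →L[ℂ] K)) : Set (K →L[ℂ] K) :=
  {w | ∃ a ∈ T₁, ∃ b ∈ T₂, w = a ∘L ContinuousLinearMap.adjoint b}

/-- The set `{a* b : a ∈ T₁, b ∈ T₂} ⊆ B(H)`. -/
def setStarMul (T₁ T₂ : Set (H →L[ℂ] K)) : Set (H →L[ℂ] H) :=
  {w | ∃ a ∈ T₁, ∃ b ∈ T₂, w = ContinuousLinearMap.adjoint a ∘L b}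

/-- Nondegeneracy of a sub-TRO `X ⊆ T`: `⟨X T* T⟩ = T` and `⟨T T* X⟩ = T`. -/
def Nondegenerate (T X : Set (H →L[ℂ] K)) : Prop :=
  cspan {w | ∃ x ∈ X, ∃ a ∈ T, ∃ b ∈ T, w = tp x a b} = T ∧
  cspan {w | ∃ a ∈ T, ∃ b ∈ T, ∃ x ∈ X, w = tp a b x} = T

/-- A TRO conditional expectation from `T` onto the sub-TRO `X`: a linear idempotent
surjection `P : T → X` (formalised as a map of the ambient space which is linear on `T`,
maps `T` into `X` and fixes `X`) satisfying the three module identities. -/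
def IsTROCondExp (T X : Set (H →L[ℂ] K)) (P : (H →L[ℂ] K) → (H →L[ℂ] K)) : Prop :=
  (∀ s ∈ T, ∀ t ∈ T, P (s + t) = P s + P t) ∧
  (∀ (z : ℂ), ∀ t ∈ T, P (z • t) = z • P t) ∧
  (∀ t ∈ T, P t ∈ X) ∧ (∀ x ∈ X, P x = x) ∧
  (∀ a ∈ T, ∀ x ∈ X, ∀ y ∈ X, P (tp a x y) = tp (P a) x y) ∧
  (∀ a ∈ T, ∀ x ∈ X, ∀ y ∈ X, P (tp x a y) = tp x (P a) y) ∧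
  (∀ a ∈ T, ∀ x ∈ X, ∀ y ∈ X, P (tp x y a) = tp x y (P a))

/-- `P` is contractive on the set `S`. -/
def ContractiveOn {V W : Type*} [Norm V] [Norm W] (S : Set V) (P : V → W) : Prop :=
  ∀ v ∈ S, ‖P v‖ ≤ ‖v‖

/-- The defining properties of the left corner map `Q = P P† : ⟨T T*⟩ → ⟨T T*⟩`:
it maps `⟨T T*⟩` into itself, is linear and contractive on `⟨T T*⟩`
and satisfies `Q(a x*) = P(a) x*` for `a ∈ T`, `x ∈ X`. -/
def IsLeftCornerMap (T X : Set (H →L[ℂ] K))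
    (P : (H →L[ℂ] K) → (H →L[ℂ] K)) (Q : (K →L[ℂ] K) → (K →L[ℂ] K)) : Prop :=
  (∀ c ∈ cspan (setMulStar T T), Q c ∈ cspan (setMulStar T T)) ∧
  (∀ c ∈ cspan (setMulStar T T), ∀ d ∈ cspan (setMulStar T T), Q (c + d) = Q c + Q d) ∧
  (∀ (z : ℂ), ∀ c ∈ cspan (setMulStar T T), Q (z • c) = z • Q c) ∧
  (∀ c ∈ cspan (setMulStar T T), ‖Q c‖ ≤ ‖c‖) ∧
  (∀ a ∈ T, ∀ x ∈ X,
    Q (a ∘L ContinuousLinearMap.adjoint x) = P a ∘L ContinuousLinearMap.adjoint x)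

/-- The defining properties of the right corner map `Q' = P† P : ⟨T* T⟩ → ⟨T* T⟩`:
it maps `⟨T* T⟩` into itself, is linear and contractive on `⟨T* T⟩`
and satisfies `Q'(x* a) = x* P(a)` for `a ∈ T`, `x ∈ X`. -/
def IsRightCornerMap (T X : Set (H →L[ℂ] K))
    (P : (H →L[ℂ] K) → (H →L[ℂ] K)) (Q' : (H →L[ℂ] H) → (H →L[ℂ] H)) : Prop :=
  (∀ d ∈ cspan (setStarMul T T), Q' d ∈ cspan (setStarMul T T)) ∧
  (∀ c ∈ cspan (setStarMul T T), ∀ d ∈ cspan (setStarMul T T), Q' (c + d) = Q' c + Q' d) ∧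
  (∀ (z : ℂ), ∀ d ∈ cspan (setStarMul T T), Q' (z • d) = z • Q' d) ∧
  (∀ d ∈ cspan (setStarMul T T), ‖Q' d‖ ≤ ‖d‖) ∧
  (∀ a ∈ T, ∀ x ∈ X,
    Q' (ContinuousLinearMap.adjoint x ∘L a) = ContinuousLinearMap.adjoint x ∘L P a)

/-- Induction principle for membership in a closed linear span. -/
theorem cspan_induction {V : Type*} [NormedAddCommGroup V] [NormedSpace ℂ V] {S : Set V}
    {p : V → Prop} (mem : ∀ v ∈ S, p v) (zero : p 0) (add : ∀ v w, p v → p w → p (v + w))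
    (smul : ∀ (z : ℂ) v, p v → p (z • v)) (closed : IsClosed {v | p v}) {v : V}
    (hv : v ∈ cspan S) : p v := by
  have hsub : (Submodule.span ℂ S : Set V) ⊆ {v | p v} := fun w hw =>
    Submodule.span_induction (p := fun v _ => p v) mem zero (fun v w _ _ => add v w)
      (fun z v _ => smul z v) hw
  exact closure_minimal hsub closed hv

theorem subset_cspan {V : Type*} [NormedAddCommGroup V] [NormedSpace ℂ V] {S : Set V} {v : V}
    (hv : v ∈ S) : v ∈ cspan S :=
  subset_closure (Submodule.subset_span hv)

theorem isClosed_cspan {V : Type*} [NormedAddCommGroup V] [NormedSpace ℂ V] (S : Set V) :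
    IsClosed (cspan S) :=
  isClosed_closure

theorem zero_mem_cspan {V : Type*} [NormedAddCommGroup V] [NormedSpace ℂ V] (S : Set V) :
    (0 : V) ∈ cspan S :=
  (Submodule.span ℂ S).topologicalClosure.zero_mem

theorem add_mem_cspan {V : Type*} [NormedAddCommGroup V] [NormedSpace ℂ V] {S : Set V} {v w : V}
    (hv : v ∈ cspan S) (hw : w ∈ cspan S) : v + w ∈ cspan S :=
  (Submodule.span ℂ S).topologicalClosure.add_mem hv hw

theorem smul_mem_cspan {V : Type*} [NormedAddCommGroup V] [NormedSpace ℂ V] {S : Set V} (z : ℂ)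
    {v : V} (hv : v ∈ cspan S) : z • v ∈ cspan S :=
  (Submodule.span ℂ S).topologicalClosure.smul_mem z hv

theorem cspan_mono {V : Type*} [NormedAddCommGroup V] [NormedSpace ℂ V] {S S' : Set V}
    (h : S ⊆ S') : cspan S ⊆ cspan S' :=
  closure_mono (Submodule.span_mono h)

theorem setStarMul_mono {T₁ T₂ X₁ X₂ : Set (H →L[ℂ] K)} (h₁ : X₁ ⊆ T₁) (h₂ : X₂ ⊆ T₂) :
    setStarMul X₁ X₂ ⊆ setStarMul T₁ T₂ := by
  rintro _ ⟨a, ha, b, hb, rfl⟩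
  exact ⟨a, h₁ ha, b, h₂ hb, rfl⟩

/-- A TRO `T` is a right module over `⟨T* T⟩`. -/
theorem comp_mem_of_mem_cspan {T : Set (H →L[ℂ] K)} (hT : IsTRO T) {a : H →L[ℂ] K} (ha : a ∈ T)
    {d : H →L[ℂ] H} (hd : d ∈ cspan (setStarMul T T)) : a ∘L d ∈ T := by
  obtain ⟨hcl, ⟨S, rfl⟩, htp⟩ := hT
  refine cspan_induction (p := fun d => a ∘L d ∈ (S : Set (H →L[ℂ] K))) ?_ ?_ ?_ ?_ ?_ hd
  · rintro _ ⟨b, hb, c, hc, rfl⟩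
    exact htp a ha b hb c hc
  · simp
  · intro v w hv hw
    rw [comp_add]
    exact S.add_mem hv hw
  · intro z v hv
    rw [comp_smul]
    exact S.smul_mem z hv
  · exact hcl.preimage (by fun_prop)

theorem IsSubTRO.isTRO {T X : Set (H →L[ℂ] K)} (hX : IsSubTRO T X) : IsTRO X := hX.2

theorem cspan_setStarMul_comp_mem {T : Set (H →L[ℂ] K)} (hT : IsTRO T) {c d : H →L[ℂ] H}
    (hc : c ∈ cspan (setStarMul T T)) (hd : d ∈ cspan (setStarMul T T)) :
    c ∘L d ∈ cspan (setStarMul T T) := by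
  refine cspan_induction (p := fun c => c ∘L d ∈ cspan (setStarMul T T)) ?_ ?_ ?_ ?_ ?_ hc
  · rintro _ ⟨a, ha, b, hb, rfl⟩
    exact subset_cspan ⟨a, ha, b ∘L d, comp_mem_of_mem_cspan hT hb hd, rfl⟩
  · simpa using zero_mem_cspan _
  · intro v w hv hw
    rw [add_comp]
    exact add_mem_cspan hv hw
  · intro z v hv
    rw [smul_comp]
    exact smul_mem_cspan z hv
  · exact (isClosed_cspan _).preimage (by fun_prop)

theorem adjoint_mem_cspan {T : Set (H →L[ℂ] K)} {d : H →L[ℂ] H}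
    (hd : d ∈ cspan (setStarMul T T)) : adjoint d ∈ cspan (setStarMul T T) := by
  refine cspan_induction (p := fun d => adjoint d ∈ cspan (setStarMul T T)) ?_ ?_ ?_ ?_ ?_ hd
  · rintro _ ⟨a, ha, b, hb, rfl⟩
    exact subset_cspan ⟨b, hb, a, ha, by simp [adjoint_comp]⟩
  · simpa using zero_mem_cspan _
  · intro v w hv hw
    rw [map_add]
    exact add_mem_cspan hv hw
  · intro z v hv
    rw [map_smulₛₗ]
    exact smul_mem_cspan _ hv
  · exact (isClosed_cspan _).preimage (adjoint (𝕜 := ℂ) (E := H) (F := H)).continuous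

/-- Under nondegeneracy, `⟨T* T⟩ = ⟨X* T⟩`. -/
theorem cspan_setStarMul_subset {T X : Set (H →L[ℂ] K)} (hT : IsTRO T)
    (hXnd : Nondegenerate T X) : cspan (setStarMul T T) ⊆ cspan (setStarMul X T) := by
  intro d hd
  refine cspan_induction ?_ (zero_mem_cspan _) (fun _ _ => add_mem_cspan)
    (fun z _ => smul_mem_cspan z) (isClosed_cspan _) hd
  rintro _ ⟨a, ha, t, ht, rfl⟩
  rw [← hXnd.2] at ha
  refine cspan_induction (p := fun a => adjoint a ∘L t ∈ cspan (setStarMul X T))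
    ?_ ?_ ?_ ?_ ?_ ha
  · rintro _ ⟨e, he, f, hf, x, hx, rfl⟩
    exact subset_cspan ⟨x, hx, tp f e t, hT.2.2 f hf e he t ht,
      by simp [tp, adjoint_comp, comp_assoc]⟩
  · simpa using zero_mem_cspan _
  · intro v w hv hw
    rw [map_add, add_comp]
    exact add_mem_cspan hv hw
  · intro z v hv
    rw [map_smulₛₗ, smul_comp]
    exact smul_mem_cspan _ hv
  · refine (isClosed_cspan _).preimage ?_
    have := (adjoint (𝕜 := ℂ) (E := H) (F := K)).continuous
    fun_prop

/-- Left multiplication by an element of the algebraic span of `X* X` is bounded in terms of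
left multiplication by elements of `X`. -/
theorem exists_norm_comp_le {X : Set (H →L[ℂ] K)} {d : H →L[ℂ] H}
    (hd : d ∈ Submodule.span ℂ (setStarMul X X)) :
    ∃ M : ℝ, ∀ (e : H →L[ℂ] H) (ρ : ℝ), (∀ y ∈ X, ‖y ∘L e‖ ≤ ρ * ‖y‖) → ‖d ∘L e‖ ≤ M * ρ := by
  induction hd using Submodule.span_induction with
  | mem d hd =>
    obtain ⟨x, hx, y, hy, rfl⟩ := hd
    refine ⟨‖x‖ * ‖y‖, fun e ρ h => ?_⟩
    calc ‖(adjoint x ∘L y) ∘L e‖ ≤ ‖adjoint x‖ * ‖y ∘L e‖ := by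
          rw [comp_assoc]; exact opNorm_comp_le _ _
      _ = ‖x‖ * ‖y ∘L e‖ := by rw [LinearIsometryEquiv.norm_map]
      _ ≤ ‖x‖ * (ρ * ‖y‖) := by gcongr; exact h y hy
      _ = ‖x‖ * ‖y‖ * ρ := by ring
  | zero => exact ⟨0, fun e ρ _ => by simp⟩
  | add v w _ _ hv hw =>
    obtain ⟨M, hM⟩ := hv
    obtain ⟨N, hN⟩ := hw
    refine ⟨M + N, fun e ρ h => ?_⟩
    rw [add_comp, add_mul]
    exact (norm_add_le _ _).trans (add_le_add (hM e ρ h) (hN e ρ h))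
  | smul z v _ hv =>
    obtain ⟨M, hM⟩ := hv
    refine ⟨‖z‖ * M, fun e ρ h => ?_⟩
    rw [smul_comp, norm_smul, mul_assoc]
    gcongr
    exact hM e ρ h

theorem norm_comp_pow_le {X : Set (H →L[ℂ] K)} (hX : IsTRO X) {c : H →L[ℂ] H}
    (hc : c ∈ cspan (setStarMul X X)) {r : ℝ} (hr : 0 ≤ r) (h : ∀ y ∈ X, ‖y ∘L c‖ ≤ r * ‖y‖)
    (n : ℕ) : ∀ y ∈ X, ‖y ∘L (c ^ n)‖ ≤ r ^ n * ‖y‖ := by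
  induction n with
  | zero => intro y _; simp [one_def]
  | succ n ih =>
    intro y hy
    rw [pow_succ', mul_def, ← comp_assoc]
    calc ‖(y ∘L c) ∘L (c ^ n)‖ ≤ r ^ n * ‖y ∘L c‖ := ih _ (comp_mem_of_mem_cspan hX hy hc)
      _ ≤ r ^ n * (r * ‖y‖) := by gcongr; exact h y hy
      _ = r ^ (n + 1) * ‖y‖ := by ring

/-- The right action of the self-adjoint part of `⟨X* X⟩` on `X` is bounded below in norm. -/
theorem norm_le_of_isSelfAdjoint {X : Set (H →L[ℂ] K)} (hX : IsTRO X) {c : H →L[ℂ] H}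
    (hc : c ∈ cspan (setStarMul X X)) (hsa : IsSelfAdjoint c) {r : ℝ} (hr : 0 ≤ r)
    (h : ∀ y ∈ X, ‖y ∘L c‖ ≤ r * ‖y‖) : ‖c‖ ≤ r := by
  by_contra! hlt
  have hpos : 0 < ‖c‖ := hr.trans_lt hlt
  obtain ⟨d, hd, hcd⟩ := Metric.mem_closure_iff.mp hc (‖c‖ / 2) (by positivity)
  rw [dist_eq_norm] at hcd
  obtain ⟨M, hM⟩ := exists_norm_comp_le hd
  have key (n : ℕ) : ‖c‖ / 2 ≤ M * (r / ‖c‖) ^ (2 ^ n - 1) := by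
    obtain ⟨m, hm⟩ : ∃ m, 2 ^ n = m + 1 :=
      ⟨2 ^ n - 1, (Nat.sub_add_cancel Nat.one_le_two_pow).symm⟩
    have hpow : ‖c ^ (m + 1)‖ = ‖c‖ ^ (m + 1) := by
      rw [← hm]
      exact hsa.norm_pow_two_pow n
    have hcm : ‖c ^ m‖ ≤ ‖c‖ ^ m := by
      rcases Nat.eq_zero_or_pos m with rfl | hm0
      · simpa [one_def] using norm_id_le
      · exact norm_pow_le' c hm0
    have hsplit : c ^ (m + 1) = (c - d) * c ^ m + d * c ^ m := by
      rw [pow_succ']; noncomm_ring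
    have hle : ‖c‖ ^ (m + 1) ≤ ‖c‖ / 2 * ‖c‖ ^ m + M * r ^ m := by
      rw [← hpow, hsplit]
      refine (norm_add_le _ _).trans (add_le_add ?_ (hM _ _ (norm_comp_pow_le hX hc hr h m)))
      exact (norm_mul_le _ _).trans (by gcongr)
    rw [hm, Nat.add_sub_cancel, div_pow, mul_div_assoc', le_div_iff₀ (by positivity)]
    rw [pow_succ] at hle
    linarith
  have hexp : Filter.Tendsto (fun n : ℕ => 2 ^ n - 1) Filter.atTop Filter.atTop :=
    (Filter.tendsto_sub_atTop_nat 1).comp (tendsto_pow_atTop_atTop_of_one_lt one_lt_two)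
  have hlim := ((tendsto_pow_atTop_nhds_zero_of_lt_one (by positivity)
    ((div_lt_one hpos).mpr hlt)).comp hexp).const_mul M
  have := ge_of_tendsto' hlim key
  linarith

/-- The right action of `⟨X* X⟩` on `X` is bounded below in norm. -/
theorem norm_le_of_forall_norm_comp_le {X : Set (H →L[ℂ] K)} (hX : IsTRO X) {b : H →L[ℂ] H}
    (hb : b ∈ cspan (setStarMul X X)) {r : ℝ} (hr : 0 ≤ r)
    (h : ∀ y ∈ X, ‖y ∘L b‖ ≤ r * ‖y‖) : ‖b‖ ≤ r := by
  have hle : ‖b ∘L adjoint b‖ ≤ r * ‖b‖ := by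
    refine norm_le_of_isSelfAdjoint hX (cspan_setStarMul_comp_mem hX hb (adjoint_mem_cspan hb))
      (IsSelfAdjoint.mul_star_self b) (by positivity) fun y hy => ?_
    calc ‖(y ∘L b) ∘L adjoint b‖ ≤ ‖y ∘L b‖ * ‖adjoint b‖ := opNorm_comp_le _ _
      _ = ‖y ∘L b‖ * ‖b‖ := by rw [LinearIsometryEquiv.norm_map]
      _ ≤ r * ‖y‖ * ‖b‖ := by gcongr; exact h y hy
      _ = r * ‖b‖ * ‖y‖ := by ring
  have hstar : ‖b ∘L adjoint b‖ = ‖b‖ * ‖b‖ := CStarRing.norm_self_mul_star (x := b)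
  rcases (norm_nonneg b).eq_or_lt with h0 | h0
  · rwa [← h0]
  · rw [hstar] at hle
    exact le_of_mul_le_mul_right hle h0

theorem continuousOn_of_contractiveOn {V : Type*} [NormedAddCommGroup V] [NormedSpace ℂ V]
    {S : Submodule ℂ V} {P : V → V} (hadd : ∀ s ∈ S, ∀ t ∈ S, P (s + t) = P s + P t)
    (hsmul : ∀ (z : ℂ), ∀ t ∈ S, P (z • t) = z • P t) (hPc : ContractiveOn (S : Set V) P) :
    ContinuousOn P (S : Set V) := by
  have hlip : LipschitzOnWith 1 P (S : Set V) := by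
    refine LipschitzOnWith.of_dist_le_mul fun s hs t ht => ?_
    have hneg : P (-t) = -P t := by simpa using hsmul (-1) t ht
    have hsub : P s - P t = P (s - t) := by
      rw [sub_eq_add_neg s t, hadd s hs (-t) (S.neg_mem ht), hneg, sub_eq_add_neg]
    simpa [dist_eq_norm, hsub] using hPc (s - t) (S.sub_mem hs ht)
  exact hlip.continuousOn

/-- `b` is the value at `d` of the right corner map of `P`: it lies in `⟨X* X⟩` and
`P (y d) = y b` for all `y ∈ X`. -/
def IsRightCornerValue (T X : Set (H →L[ℂ] K)) (P : (H →L[ℂ] K) → (H →L[ℂ] K))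
    (d b : H →L[ℂ] H) : Prop :=
  b ∈ cspan (setStarMul X X) ∧ ∀ y ∈ X, y ∘L d ∈ T ∧ P (y ∘L d) = y ∘L b

section RightCornerValue

variable {T X : Set (H →L[ℂ] K)} {P : (H →L[ℂ] K) → (H →L[ℂ] K)}

theorem isClosed_graph_of_isTROCondExp (hT : IsTRO T) (hP : IsTROCondExp T X P)
    (hPc : ContractiveOn T P) :
    IsClosed {q : (H →L[ℂ] K) × (H →L[ℂ] K) | q.1 ∈ T ∧ P q.1 = q.2} := by
  obtain ⟨hcl, ⟨S, rfl⟩, -⟩ := hT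
  have hcont : ContinuousOn (fun q : (H →L[ℂ] K) × (H →L[ℂ] K) => P q.1 - q.2)
      (Prod.fst ⁻¹' (S : Set (H →L[ℂ] K))) :=
    ((continuousOn_of_contractiveOn hP.1 hP.2.1 hPc).comp continuousOn_fst
      fun _ hq => hq).sub continuousOn_snd
  convert hcont.preimage_isClosed_of_isClosed (hcl.preimage continuous_fst)
    (isClosed_singleton (x := 0)) using 1
  ext q
  simp [sub_eq_zero]

theorem IsRightCornerValue.norm_le (hX : IsSubTRO T X) (hPc : ContractiveOn T P)
    {d b : H →L[ℂ] H} (h : IsRightCornerValue T X P d b) : ‖b‖ ≤ ‖d‖ := by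
  refine norm_le_of_forall_norm_comp_le hX.isTRO h.1 (norm_nonneg d) fun y hy => ?_
  rw [← (h.2 y hy).2, mul_comm]
  exact (hPc _ (h.2 y hy).1).trans (opNorm_comp_le _ _)

theorem IsRightCornerValue.add (hT : IsTRO T) (hP : IsTROCondExp T X P)
    {d₁ b₁ d₂ b₂ : H →L[ℂ] H} (h₁ : IsRightCornerValue T X P d₁ b₁)
    (h₂ : IsRightCornerValue T X P d₂ b₂) : IsRightCornerValue T X P (d₁ + d₂) (b₁ + b₂) := by
  refine ⟨add_mem_cspan h₁.1 h₂.1, fun y hy => ?_⟩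
  rw [comp_add, comp_add, hP.1 _ (h₁.2 y hy).1 _ (h₂.2 y hy).1, (h₁.2 y hy).2, (h₂.2 y hy).2]
  obtain ⟨-, ⟨S, rfl⟩, -⟩ := hT
  exact ⟨S.add_mem (h₁.2 y hy).1 (h₂.2 y hy).1, rfl⟩

theorem IsRightCornerValue.smul (hT : IsTRO T) (hP : IsTROCondExp T X P) (z : ℂ)
    {d b : H →L[ℂ] H} (h : IsRightCornerValue T X P d b) :
    IsRightCornerValue T X P (z • d) (z • b) := by
  refine ⟨smul_mem_cspan z h.1, fun y hy => ?_⟩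
  rw [comp_smul, comp_smul, hP.2.1 z _ (h.2 y hy).1, (h.2 y hy).2]
  obtain ⟨-, ⟨S, rfl⟩, -⟩ := hT
  exact ⟨S.smul_mem z (h.2 y hy).1, rfl⟩

theorem IsRightCornerValue.sub (hT : IsTRO T) (hP : IsTROCondExp T X P)
    {d₁ b₁ d₂ b₂ : H →L[ℂ] H} (h₁ : IsRightCornerValue T X P d₁ b₁)
    (h₂ : IsRightCornerValue T X P d₂ b₂) : IsRightCornerValue T X P (d₁ - d₂) (b₁ - b₂) := by
  simpa [sub_eq_add_neg] using h₁.add hT hP (h₂.smul hT hP (-1))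

theorem IsRightCornerValue.unique (hT : IsTRO T) (hX : IsSubTRO T X) (hP : IsTROCondExp T X P)
    (hPc : ContractiveOn T P) {d b₁ b₂ : H →L[ℂ] H} (h₁ : IsRightCornerValue T X P d b₁)
    (h₂ : IsRightCornerValue T X P d b₂) : b₁ = b₂ := by
  simpa [sub_eq_zero] using (h₁.sub hT hP h₂).norm_le hX hPc

theorem isClosed_setOf_isRightCornerValue (hT : IsTRO T) (hP : IsTROCondExp T X P)
    (hPc : ContractiveOn T P) :
    IsClosed {q : (H →L[ℂ] H) × (H →L[ℂ] H) | IsRightCornerValue T X P q.1 q.2} := by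
  simp only [IsRightCornerValue, Set.ofPred_and, Set.ofPred_forall]
  refine ((isClosed_cspan _).preimage continuous_snd).inter
    (isClosed_iInter fun y => isClosed_iInter fun _ => ?_)
  exact (isClosed_graph_of_isTROCondExp hT hP hPc).preimage
    (f := fun q : (H →L[ℂ] H) × (H →L[ℂ] H) => (y ∘L q.1, y ∘L q.2)) (by fun_prop)

theorem isRightCornerValue_adjoint_comp (hT : IsTRO T) (hX : IsSubTRO T X)
    (hP : IsTROCondExp T X P) {a x : H →L[ℂ] K} (ha : a ∈ T) (hx : x ∈ X) :
    IsRightCornerValue T X P (adjoint x ∘L a) (adjoint x ∘L P a) :=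
  ⟨subset_cspan ⟨x, hx, P a, hP.2.2.1 a ha, rfl⟩, fun y hy =>
    ⟨hT.2.2 y (hX.1 hy) x (hX.1 hx) a ha, hP.2.2.2.2.2.2 a ha y hy x hx⟩⟩

theorem isRightCornerValue_adjoint_comp_right (hT : IsTRO T) (hX : IsSubTRO T X)
    (hP : IsTROCondExp T X P) {a x : H →L[ℂ] K} (ha : a ∈ T) (hx : x ∈ X) :
    IsRightCornerValue T X P (adjoint a ∘L x) (adjoint (P a) ∘L x) :=
  ⟨subset_cspan ⟨P a, hP.2.2.1 a ha, x, hx, rfl⟩, fun y hy =>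
    ⟨hT.2.2 y (hX.1 hy) a ha x (hX.1 hx), hP.2.2.2.2.2.1 a ha y hy x hx⟩⟩

theorem isRightCornerValue_self (hX : IsSubTRO T X) (hP : IsTROCondExp T X P) {b : H →L[ℂ] H}
    (hb : b ∈ cspan (setStarMul X X)) : IsRightCornerValue T X P b b := by
  refine ⟨hb, fun y hy => ?_⟩
  have hyb := comp_mem_of_mem_cspan hX.isTRO hy hb
  exact ⟨hX.1 hyb, hP.2.2.2.1 _ hyb⟩

theorem IsRightCornerValue.comp_left (hX : IsSubTRO T X) {d e b : H →L[ℂ] H}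
    (h : IsRightCornerValue T X P d e) (hb : b ∈ cspan (setStarMul X X)) :
    IsRightCornerValue T X P (b ∘L d) (b ∘L e) :=
  ⟨cspan_setStarMul_comp_mem hX.isTRO hb h.1, fun _ hy =>
    h.2 _ (comp_mem_of_mem_cspan hX.isTRO hy hb)⟩

/-- A contractive TRO conditional expectation is a right `⟨X* X⟩`-module map. -/
theorem map_comp_of_mem_cspan (hT : IsTRO T) (hX : IsSubTRO T X) (hP : IsTROCondExp T X P)
    (hPc : ContractiveOn T P) {a : H →L[ℂ] K} (ha : a ∈ T) {b : H →L[ℂ] H}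
    (hb : b ∈ cspan (setStarMul X X)) : a ∘L b ∈ T ∧ P (a ∘L b) = P a ∘L b := by
  have hgraph := isClosed_graph_of_isTROCondExp hT hP hPc
  obtain ⟨hPadd, hPsmul, -, -, hPr, -⟩ := hP
  obtain ⟨-, ⟨S, rfl⟩, htp⟩ := hT
  refine cspan_induction
    (p := fun b => a ∘L b ∈ (S : Set (H →L[ℂ] K)) ∧ P (a ∘L b) = P a ∘L b) ?_ ?_ ?_ ?_ ?_ hb
  · rintro _ ⟨x, hx, y, hy, rfl⟩
    exact ⟨htp a ha x (hX.1 hx) y (hX.1 hy), hPr a ha x hx y hy⟩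
  · have h0 : P 0 = 0 := by simpa using hPsmul 0 0 S.zero_mem
    simp [h0]
  · intro v w hv hw
    rw [comp_add, comp_add, hPadd _ hv.1 _ hw.1, hv.2, hw.2]
    exact ⟨S.add_mem hv.1 hw.1, rfl⟩
  · intro z v hv
    rw [comp_smul, comp_smul, hPsmul z _ hv.1, hv.2]
    exact ⟨S.smul_mem z hv.1, rfl⟩
  · exact hgraph.preimage (f := fun b : H →L[ℂ] H => (a ∘L b, P a ∘L b)) (by fun_prop)

theorem IsRightCornerValue.comp_right (hT : IsTRO T) (hX : IsSubTRO T X)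
    (hP : IsTROCondExp T X P) (hPc : ContractiveOn T P) {d e b : H →L[ℂ] H}
    (h : IsRightCornerValue T X P d e) (hb : b ∈ cspan (setStarMul X X)) :
    IsRightCornerValue T X P (d ∘L b) (e ∘L b) := by
  refine ⟨cspan_setStarMul_comp_mem hX.isTRO h.1 hb, fun y hy => ?_⟩
  rw [← comp_assoc, ← comp_assoc, ← (h.2 y hy).2]
  exact map_comp_of_mem_cspan hT hX hP hPc (h.2 y hy).1 hb

theorem isClosed_setOf_exists_isRightCornerValue (hT : IsTRO T) (hX : IsSubTRO T X)
    (hP : IsTROCondExp T X P) (hPc : ContractiveOn T P) :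
    IsClosed {d | ∃ b, IsRightCornerValue T X P d b} := by
  refine IsSeqClosed.isClosed fun d d₀ hd hlim => ?_
  choose b hb using hd
  have hcauchy : CauchySeq b := by
    refine Metric.cauchySeq_iff.mpr fun ε hε => ?_
    obtain ⟨N, hN⟩ := Metric.cauchySeq_iff.mp hlim.cauchySeq ε hε
    refine ⟨N, fun m hm n hn => lt_of_le_of_lt ?_ (hN m hm n hn)⟩
    simpa [dist_eq_norm] using ((hb m).sub hT hP (hb n)).norm_le hX hPc
  obtain ⟨b₀, hb₀⟩ := cauchySeq_tendsto_of_complete hcauchy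
  exact ⟨b₀, (isClosed_setOf_isRightCornerValue hT hP hPc).mem_of_tendsto
    (hlim.prodMk_nhds hb₀) (Filter.Eventually.of_forall hb)⟩

theorem exists_isRightCornerValue (hT : IsTRO T) (hX : IsSubTRO T X) (hXnd : Nondegenerate T X)
    (hP : IsTROCondExp T X P) (hPc : ContractiveOn T P) {d : H →L[ℂ] H}
    (hd : d ∈ cspan (setStarMul T T)) : ∃ b, IsRightCornerValue T X P d b := by
  refine cspan_induction ?_ ⟨0, isRightCornerValue_self hX hP (zero_mem_cspan _)⟩ ?_ ?_
    (isClosed_setOf_exists_isRightCornerValue hT hX hP hPc) (cspan_setStarMul_subset hT hXnd hd)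
  · rintro _ ⟨x, hx, a, ha, rfl⟩
    exact ⟨_, isRightCornerValue_adjoint_comp hT hX hP ha hx⟩
  · rintro v w ⟨b, hb⟩ ⟨c, hc⟩
    exact ⟨_, hb.add hT hP hc⟩
  · rintro z v ⟨b, hb⟩
    exact ⟨_, hb.smul hT hP z⟩

end RightCornerValue

/-- Two right corner maps of `P` agree on `⟨T* T⟩`. -/
theorem IsRightCornerMap.eq_of_mem_cspan {T X : Set (H →L[ℂ] K)}
    {P : (H →L[ℂ] K) → (H →L[ℂ] K)} (hT : IsTRO T) (hX : IsSubTRO T X)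
    (hXnd : Nondegenerate T X) {Q₁ Q₂ : (H →L[ℂ] H) → (H →L[ℂ] H)}
    (h₁ : IsRightCornerMap T X P Q₁) (h₂ : IsRightCornerMap T X P Q₂) {d : H →L[ℂ] H}
    (hd : d ∈ cspan (setStarMul T T)) : Q₁ d = Q₂ d := by
  have hcont {Q : (H →L[ℂ] H) → (H →L[ℂ] H)} (h : IsRightCornerMap T X P Q) :
      ContinuousOn Q (cspan (setStarMul T T)) :=
    continuousOn_of_contractiveOn
      (S := (Submodule.span ℂ (setStarMul T T)).topologicalClosure) h.2.1 h.2.2.1 h.2.2.2.1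
  refine (cspan_induction (p := fun d => d ∈ cspan (setStarMul T T) ∧ Q₁ d = Q₂ d)
    ?_ ?_ ?_ ?_ ?_ (cspan_setStarMul_subset hT hXnd hd)).2
  · rintro _ ⟨x, hx, a, ha, rfl⟩
    exact ⟨subset_cspan ⟨x, hX.1 hx, a, ha, rfl⟩,
      by rw [h₁.2.2.2.2 a ha x hx, h₂.2.2.2.2 a ha x hx]⟩
  · refine ⟨zero_mem_cspan _, ?_⟩
    have h₁0 := h₁.2.2.1 0 0 (zero_mem_cspan _)
    have h₂0 := h₂.2.2.1 0 0 (zero_mem_cspan _)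
    simp only [zero_smul] at h₁0 h₂0
    rw [h₁0, h₂0]
  · rintro v w ⟨hv, hv'⟩ ⟨hw, hw'⟩
    exact ⟨add_mem_cspan hv hw, by rw [h₁.2.1 v hv w hw, h₂.2.1 v hv w hw, hv', hw']⟩
  · rintro z v ⟨hv, hv'⟩
    exact ⟨smul_mem_cspan z hv, by rw [h₁.2.2.1 z v hv, h₂.2.2.1 z v hv, hv']⟩
  · have heq : {d | d ∈ cspan (setStarMul T T) ∧ Q₁ d = Q₂ d} =
        cspan (setStarMul T T) ∩ (fun d => Q₁ d - Q₂ d) ⁻¹' {0} := by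
      ext d
      simp [sub_eq_zero]
    rw [heq]
    exact ((hcont h₁).sub (hcont h₂)).preimage_isClosed_of_isClosed (isClosed_cspan _)
      isClosed_singleton

/-- Existence and uniqueness of the conditional expectation
`Q' = P† P : ⟨T* T⟩ → ⟨X* X⟩`. -/
theorem exists_unique_right_corner_map
    (T X : Set (H →L[ℂ] K)) (P : (H →L[ℂ] K) → (H →L[ℂ] K))
    (hT : IsTRO T) (hX : IsSubTRO T X) (hXnd : Nondegenerate T X)
    (hP : IsTROCondExp T X P) (hPc : ContractiveOn T P) :
    ∃ Q' : (H →L[ℂ] H) → (H →L[ℂ] H), IsRightCornerMap T X P Q' ∧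
      -- uniqueness: any map with these properties agrees with `Q'` on `⟨T* T⟩`
      (∀ Q₂, IsRightCornerMap T X P Q₂ → ∀ d ∈ cspan (setStarMul T T), Q₂ d = Q' d) ∧
      -- `Q'` is idempotent
      (∀ d ∈ cspan (setStarMul T T), Q' (Q' d) = Q' d) ∧
      -- the range of `Q'` is `⟨X* X⟩`
      (∀ d ∈ cspan (setStarMul T T), Q' d ∈ cspan (setStarMul X X)) ∧
      (∀ b ∈ cspan (setStarMul X X), Q' b = b) ∧
      -- `Q' (a* x) = P(a)* x`
      (∀ a ∈ T, ∀ x ∈ X, Q' (ContinuousLinearMap.adjoint a ∘L x)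
          = ContinuousLinearMap.adjoint (P a) ∘L x) ∧
      -- `Q'` is a `⟨X* X⟩`-bimodule map, i.e. a conditional expectation onto `⟨X* X⟩`
      (∀ d ∈ cspan (setStarMul T T), ∀ b ∈ cspan (setStarMul X X),
          Q' (d ∘L b) = Q' d ∘L b ∧ Q' (b ∘L d) = b ∘L Q' d) := by
  classical
  have hex := fun d (hd : d ∈ cspan (setStarMul T T)) =>
    exists_isRightCornerValue hT hX hXnd hP hPc hd
  have hsub : cspan (setStarMul X X) ⊆ cspan (setStarMul T T) :=
    cspan_mono (setStarMul_mono hX.1 hX.1)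
  let Q : (H →L[ℂ] H) → (H →L[ℂ] H) := fun d =>
    if hd : d ∈ cspan (setStarMul T T) then (hex d hd).choose else 0
  have hQ : ∀ d ∈ cspan (setStarMul T T), IsRightCornerValue T X P d (Q d) := by
    intro d hd
    simp only [Q, dif_pos hd]
    exact (hex d hd).choose_spec
  have hQeq {d b : H →L[ℂ] H} (hd : d ∈ cspan (setStarMul T T))
      (h : IsRightCornerValue T X P d b) : Q d = b := (hQ d hd).unique hT hX hP hPc h
  have hQself : ∀ b ∈ cspan (setStarMul X X), Q b = b := fun b hb =>
    hQeq (hsub hb) (isRightCornerValue_self hX hP hb)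
  have hmap : IsRightCornerMap T X P Q :=
    ⟨fun d hd => hsub (hQ d hd).1,
      fun c hc d hd => hQeq (add_mem_cspan hc hd) ((hQ c hc).add hT hP (hQ d hd)),
      fun z d hd => hQeq (smul_mem_cspan z hd) ((hQ d hd).smul hT hP z),
      fun d hd => (hQ d hd).norm_le hX hPc,
      fun a ha x hx => hQeq (subset_cspan ⟨x, hX.1 hx, a, ha, rfl⟩)
        (isRightCornerValue_adjoint_comp hT hX hP ha hx)⟩
  exact ⟨Q, hmap, fun Q₂ h₂ d hd => h₂.eq_of_mem_cspan hT hX hXnd hmap hd,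
    fun d hd => hQself _ (hQ d hd).1, fun d hd => (hQ d hd).1, hQself,
    fun a ha x hx => hQeq (subset_cspan ⟨a, ha, x, hX.1 hx, rfl⟩)
      (isRightCornerValue_adjoint_comp_right hT hX hP ha hx),
    fun d hd b hb =>
      ⟨hQeq (cspan_setStarMul_comp_mem hT hd (hsub hb))
        ((hQ d hd).comp_right hT hX hP hPc hb),
      hQeq (cspan_setStarMul_comp_mem hT (hsub hb) hd) ((hQ d hd).comp_left hX hb)⟩⟩
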